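/- For every plain monotonic triple rule r and all triple graphs G = (G_S ← G_C → G_T) and H = (H_S ← H_C → H_T), there is a transformation step G ⇒_{r,m} H at injective match m = (m_S, m_C, m_T) if and only if there are transformation steps G ⇒_{r^S,(m_S,∅,∅)} G' ⇒_{r^F,(n_S,m_C,m_T)} H, where G' = (H_S ← G_C → G_T) (with the correspondence morphism of G composed with the inclusion G_S ⊆ H_S) and n_S is the source component of the comatch of the first step. -/

import Mathlib

/-!
Set-theoretic formalization of (partial) triple graphs, triple graph grammars (TGGs),
their operationalizations and short-cut rules, following
Fritsche, Kosiol, Schürr, Taentzer: "Avoiding Unnecessary Information Loss".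

A graph is given by a set of node names and a set of edges, where an edge is a
name together with its source and target node (this encodes the source and
target functions).  Subgraphs, unions, intersections and differences are plain
set-theoretic operations.  Correspondence morphisms of (partial) triple graphs
are encoded as functional relations; a *triple graph* in the strict sense is a
`Total` one, a general inhabitant of `Triple` is a *partial triple graph*.
-/

namespace TGGPaper

structure Graph (V E : Type) where
  verts : Set V
  edges : Set (E × V × V)

namespace Graph

variable {V E : Type}

/-- The set of edge names occurring in `G`. -/
def edgeNames (G : Graph V E) : Set E := {e | ∃ u w, (e, u, w) ∈ G.edges}

/-- Well-formedness: endpoints of edges are nodes of the graph, and an edge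
name determines its source and target node. -/
def WF (G : Graph V E) : Prop :=
  (∀ x ∈ G.edges, x.2.1 ∈ G.verts ∧ x.2.2 ∈ G.verts) ∧
  (∀ x ∈ G.edges, ∀ y ∈ G.edges, x.1 = y.1 → x = y)

/-- Subgraph relation. -/
def Sub (H G : Graph V E) : Prop := H.verts ⊆ G.verts ∧ H.edges ⊆ G.edges

/-- The empty graph. -/
def emptyG (V E : Type) : Graph V E := ⟨∅, ∅⟩

/-- Finiteness of a graph. -/
def IsFinite (G : Graph V E) : Prop := G.verts.Finite ∧ G.edges.Finite

end Graph

/-- The data of a graph morphism: functions on node names and edge names. -/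
structure GMap (V E : Type) where
  onV : V → V
  onE : E → E

namespace GMap

variable {V E : Type}

/-- The induced action on edges. -/
def onEdge (f : GMap V E) (x : E × V × V) : E × V × V :=
  (f.onE x.1, f.onV x.2.1, f.onV x.2.2)

/-- `f` is a graph morphism from `G` to `H` (preservation of sources and
targets of edges is built into the action on edges). -/
def IsHom (f : GMap V E) (G H : Graph V E) : Prop :=
  (∀ v ∈ G.verts, f.onV v ∈ H.verts) ∧ (∀ x ∈ G.edges, f.onEdge x ∈ H.edges)

/-- `f` is injective on `G`. -/
def InjOn (f : GMap V E) (G : Graph V E) : Prop :=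
  Set.InjOn f.onV G.verts ∧ Set.InjOn f.onE G.edgeNames

end GMap

/-- A (partial) triple graph: source, correspondence and target graph together
with the correspondence morphisms `σ` (towards source) and `τ` (towards
target), encoded as functional relations on node and edge names.  Triple
graphs in the strict sense are the `Total` ones. -/
structure Triple (V E : Type) where
  S : Graph V E
  C : Graph V E
  T : Graph V E
  σV : Set (V × V)
  σE : Set (E × E)
  τV : Set (V × V)
  τE : Set (E × E)

namespace Triple

variable {V E : Type}

/-- Well-formedness of one correspondence morphism (as a possibly partial
graph morphism from `C` to `S`, given by relations `rV` on nodes and `rE` on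
edge names): it is functional, defined on a subgraph of `C` (its domain), maps
into `S` and commutes with sources and targets. -/
def CorrWF (C S : Graph V E) (rV : Set (V × V)) (rE : Set (E × E)) : Prop :=
  (∀ p ∈ rV, p.1 ∈ C.verts ∧ p.2 ∈ S.verts) ∧
  (∀ p ∈ rV, ∀ q ∈ rV, p.1 = q.1 → p = q) ∧
  (∀ p ∈ rE, ∀ q ∈ rE, p.1 = q.1 → p = q) ∧
  (∀ p ∈ rE, ∀ u w, (p.1, u, w) ∈ C.edges →
    ∃ u' w', (p.2, u', w') ∈ S.edges ∧ (u, u') ∈ rV ∧ (w, w') ∈ rV) ∧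
  (∀ p ∈ rE, p.1 ∈ C.edgeNames)

def WF (G : Triple V E) : Prop :=
  G.S.WF ∧ G.C.WF ∧ G.T.WF ∧ CorrWF G.C G.S G.σV G.σE ∧ CorrWF G.C G.T G.τV G.τE

/-- Totality of both correspondence morphisms: `G` is a triple graph in the
strict sense (not a properly partial one). -/
def Total (G : Triple V E) : Prop :=
  (∀ c ∈ G.C.verts, ∃ s, (c, s) ∈ G.σV) ∧ (∀ e ∈ G.C.edgeNames, ∃ e', (e, e') ∈ G.σE) ∧
  (∀ c ∈ G.C.verts, ∃ s, (c, s) ∈ G.τV) ∧ (∀ e ∈ G.C.edgeNames, ∃ e', (e, e') ∈ G.τE)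

/-- Sub-triple-graph relation. -/
def Sub (H G : Triple V E) : Prop :=
  H.S.Sub G.S ∧ H.C.Sub G.C ∧ H.T.Sub G.T ∧
  H.σV ⊆ G.σV ∧ H.σE ⊆ G.σE ∧ H.τV ⊆ G.τV ∧ H.τE ⊆ G.τE

/-- The empty triple graph. -/
def IsEmptyTriple (G : Triple V E) : Prop :=
  G.S = Graph.emptyG V E ∧ G.C = Graph.emptyG V E ∧ G.T = Graph.emptyG V E ∧
  G.σV = ∅ ∧ G.σE = ∅ ∧ G.τV = ∅ ∧ G.τE = ∅

/-- Finiteness of a triple graph. -/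
def IsFinite (G : Triple V E) : Prop :=
  G.S.IsFinite ∧ G.C.IsFinite ∧ G.T.IsFinite ∧
  G.σV.Finite ∧ G.σE.Finite ∧ G.τV.Finite ∧ G.τE.Finite

/-- The triple graph `(G_S ← ∅ → ∅)`. -/
def srcOnly (G : Triple V E) : Triple V E :=
  ⟨G.S, Graph.emptyG V E, Graph.emptyG V E, ∅, ∅, ∅, ∅⟩

/-- Replace the source graph of `X` by `HS` and restrict the correspondence
morphism `σ` to those elements that still have an image: the partial triple
graph `(HS ⇠ X_C → X_T)` induced by an edit of the source graph. -/
def withSource (X : Triple V E) (HS : Graph V E) : Triple V E :=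
  ⟨HS, X.C, X.T,
   {q ∈ X.σV | q.2 ∈ HS.verts}, {q ∈ X.σE | q.2 ∈ HS.edgeNames},
   X.τV, X.τE⟩

/-- Componentwise union of triple graphs (used for the union of two triple
graphs along a common subgraph). -/
def union (G1 G2 : Triple V E) : Triple V E :=
  ⟨⟨G1.S.verts ∪ G2.S.verts, G1.S.edges ∪ G2.S.edges⟩,
   ⟨G1.C.verts ∪ G2.C.verts, G1.C.edges ∪ G2.C.edges⟩,
   ⟨G1.T.verts ∪ G2.T.verts, G1.T.edges ∪ G2.T.edges⟩,
   G1.σV ∪ G2.σV, G1.σE ∪ G2.σE, G1.τV ∪ G2.τV, G1.τE ∪ G2.τE⟩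

/-- `S` is componentwise the intersection of `G1` and `G2` — the standing
assumption `G1 ∩ G2 = S` when forming the union of `G1` and `G2` along `S`. -/
def MeetIn (G1 G2 S : Triple V E) : Prop :=
  G1.S.verts ∩ G2.S.verts = S.S.verts ∧ G1.S.edges ∩ G2.S.edges = S.S.edges ∧
  G1.C.verts ∩ G2.C.verts = S.C.verts ∧ G1.C.edges ∩ G2.C.edges = S.C.edges ∧
  G1.T.verts ∩ G2.T.verts = S.T.verts ∧ G1.T.edges ∩ G2.T.edges = S.T.edges ∧
  G1.σV ∩ G2.σV = S.σV ∧ G1.σE ∩ G2.σE = S.σE ∧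
  G1.τV ∩ G2.τV = S.τV ∧ G1.τE ∩ G2.τE = S.τE

end Triple

/-- The data of a triple graph morphism. -/
structure TMap (V E : Type) where
  fS : GMap V E
  fC : GMap V E
  fT : GMap V E

namespace TMap

variable {V E : Type}

/-- `f` is a morphism of (partial) triple graphs from `G` to `H`:
componentwise a graph morphism that maps the domains of the correspondence
morphisms into the corresponding domains and commutes with them there. -/
def IsHom (f : TMap V E) (G H : Triple V E) : Prop :=
  f.fS.IsHom G.S H.S ∧ f.fC.IsHom G.C H.C ∧ f.fT.IsHom G.T H.T ∧
  (∀ p ∈ G.σV, (f.fC.onV p.1, f.fS.onV p.2) ∈ H.σV) ∧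
  (∀ p ∈ G.σE, (f.fC.onE p.1, f.fS.onE p.2) ∈ H.σE) ∧
  (∀ p ∈ G.τV, (f.fC.onV p.1, f.fT.onV p.2) ∈ H.τV) ∧
  (∀ p ∈ G.τE, (f.fC.onE p.1, f.fT.onE p.2) ∈ H.τE)

/-- `f` is injective on `G` (componentwise). -/
def InjOn (f : TMap V E) (G : Triple V E) : Prop :=
  f.fS.InjOn G.S ∧ f.fC.InjOn G.C ∧ f.fT.InjOn G.T

/-- `f` and `g` agree on (all elements of) `X`, i.e. they match the same
elements when `X` is their common domain of definition. -/
def EqOn (f g : TMap V E) (X : Triple V E) : Prop :=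
  (∀ v ∈ X.S.verts, f.fS.onV v = g.fS.onV v) ∧ (∀ e ∈ X.S.edgeNames, f.fS.onE e = g.fS.onE e) ∧
  (∀ v ∈ X.C.verts, f.fC.onV v = g.fC.onV v) ∧ (∀ e ∈ X.C.edgeNames, f.fC.onE e = g.fC.onE e) ∧
  (∀ v ∈ X.T.verts, f.fT.onV v = g.fT.onV v) ∧ (∀ e ∈ X.T.edgeNames, f.fT.onE e = g.fT.onE e)

end TMap

variable {V E : Type}

/-- Isomorphism of (partial) triple graphs. -/
def TIso (X Y : Triple V E) : Prop :=
  ∃ f : TMap V E, f.IsHom X Y ∧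
    Set.BijOn f.fS.onV X.S.verts Y.S.verts ∧ Set.BijOn f.fS.onEdge X.S.edges Y.S.edges ∧
    Set.BijOn f.fC.onV X.C.verts Y.C.verts ∧ Set.BijOn f.fC.onEdge X.C.edges Y.C.edges ∧
    Set.BijOn f.fT.onV X.T.verts Y.T.verts ∧ Set.BijOn f.fT.onEdge X.T.edges Y.T.edges ∧
    (∀ p ∈ Y.σV, ∃ q ∈ X.σV, (f.fC.onV q.1, f.fS.onV q.2) = p) ∧
    (∀ p ∈ Y.σE, ∃ q ∈ X.σE, (f.fC.onE q.1, f.fS.onE q.2) = p) ∧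
    (∀ p ∈ Y.τV, ∃ q ∈ X.τV, (f.fC.onV q.1, f.fT.onV q.2) = p) ∧
    (∀ p ∈ Y.τE, ∃ q ∈ X.τE, (f.fC.onE q.1, f.fT.onE q.2) = p)

/-- A rule `L ← K → R` on (partial) triple graphs; that `K` is a common
subgraph of `L` and `R` is part of `Rule.WF`. -/
structure Rule (V E : Type) where
  L : Triple V E
  K : Triple V E
  R : Triple V E

namespace Rule

variable {V E : Type}

def WF (p : Rule V E) : Prop :=
  p.L.WF ∧ p.K.WF ∧ p.R.WF ∧ p.K.Sub p.L ∧ p.K.Sub p.R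

/-- A triple rule in the strict sense: all three parts are total. -/
def TotalRule (p : Rule V E) : Prop := p.L.Total ∧ p.K.Total ∧ p.R.Total

/-- A rule is monotonic (non-deleting) if `K = L`. -/
def Monotonic (p : Rule V E) : Prop := p.K = p.L

/-- The inverse rule `R ← K → L`. -/
def inv (p : Rule V E) : Rule V E := ⟨p.R, p.K, p.L⟩

/-- The left-hand side `(R_S ← L_C → L_T)` of the forward rule of a monotonic
rule; its correspondence morphism towards the source is `σ_R ∘ r_C`. -/
def fwdL (p : Rule V E) : Triple V E :=
  { S := p.R.S, C := p.L.C, T := p.L.T,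
    σV := {q ∈ p.R.σV | q.1 ∈ p.L.C.verts},
    σE := {q ∈ p.R.σE | q.1 ∈ p.L.C.edgeNames},
    τV := p.L.τV, τE := p.L.τE }

/-- The forward rule `r^F : (R_S ← L_C → L_T) → (R_S ← R_C → R_T)` of a plain
monotonic triple rule (a monotonic rule, acting as the identity on the source
component). -/
def fwd (p : Rule V E) : Rule V E := ⟨p.fwdL, p.fwdL, p.R⟩

/-- The source rule `(L_S ← ∅ → ∅) ← (K_S ← ∅ → ∅) → (R_S ← ∅ → ∅)`. -/
def srcRule (p : Rule V E) : Rule V E := ⟨p.L.srcOnly, p.K.srcOnly, p.R.srcOnly⟩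

/-- The left-hand side `(R_{sc,S} ⇠ L_{sc,C} → L_{sc,T})` of the forward
(repair) rule of a short-cut rule, carrying the partial correspondence
morphism induced by that of `L_sc`. -/
def fwdSCL (p : Rule V E) : Triple V E :=
  { S := p.R.S, C := p.L.C, T := p.L.T,
    σV := {q ∈ p.L.σV | q.2 ∈ p.R.S.verts},
    σE := {q ∈ p.L.σE | q.2 ∈ p.R.S.edgeNames},
    τV := p.L.τV, τE := p.L.τE }

/-- The interface `(R_{sc,S} ← K_{sc,C} → K_{sc,T})` of the forward (repair)
rule of a short-cut rule. -/
def fwdSCK (p : Rule V E) : Triple V E :=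
  { S := p.R.S, C := p.K.C, T := p.K.T,
    σV := p.K.σV, σE := p.K.σE, τV := p.K.τV, τE := p.K.τE }

/-- The forward rule (repair rule) of a short-cut rule, a rule on partial
triple graphs whose source component is the identity on `R_{sc,S}`. -/
def fwdSC (p : Rule V E) : Rule V E := ⟨p.fwdSCL, p.fwdSCK, p.R⟩

end Rule

/-- One graph component of a transformation step: the match and the comatch
agree on `K`, the created elements `n(R \ K)` are fresh, and the result arises
from `G` by node- and edge-wise deletion of `m(L \ K)` and union with
`n(R \ K)`. -/
def GraphStep (Lg Kg Rg Gg Hg : Graph V E) (m n : GMap V E) : Prop :=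
  (∀ v ∈ Kg.verts, n.onV v = m.onV v) ∧
  (∀ e ∈ Kg.edgeNames, n.onE e = m.onE e) ∧
  (∀ v ∈ Rg.verts \ Kg.verts, n.onV v ∉ Gg.verts) ∧
  (∀ e ∈ Rg.edgeNames \ Kg.edgeNames, n.onE e ∉ Gg.edgeNames) ∧
  Hg.verts = (Gg.verts \ (m.onV '' (Lg.verts \ Kg.verts))) ∪ (n.onV '' (Rg.verts \ Kg.verts)) ∧
  Hg.edges = (Gg.edges \ (m.onEdge '' (Lg.edges \ Kg.edges))) ∪ (n.onEdge '' (Rg.edges \ Kg.edges))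

/-- Deletion and union for one of the correspondence relations; kept pairs are
restricted to the surviving elements (for rules on genuine triple graphs this
restriction is vacuous, for partial triple graphs it yields the induced
partial correspondence morphism). -/
def RelStep {α : Type} (Lr Kr Rr Gr Hr : Set (α × α)) (domH codH : Set α)
    (mc ms nc ns : α → α) : Prop :=
  Hr = ({q ∈ Gr \ ((fun q : α × α => (mc q.1, ms q.2)) '' (Lr \ Kr)) |
          q.1 ∈ domH ∧ q.2 ∈ codH}) ∪
       ((fun q : α × α => (nc q.1, ns q.2)) '' (Rr \ Kr))

/-- A transformation step `G ⇒_{p,m} H` with injective match `m` and comatch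
`n` (in particular, `p` is applicable at `m`, as the intermediate result is
again a (partial) triple graph, `H` being well-formed). -/
def IsStep (p : Rule V E) (G H : Triple V E) (m n : TMap V E) : Prop :=
  G.WF ∧ H.WF ∧
  m.IsHom p.L G ∧ m.InjOn p.L ∧ n.IsHom p.R H ∧ n.InjOn p.R ∧
  GraphStep p.L.S p.K.S p.R.S G.S H.S m.fS n.fS ∧
  GraphStep p.L.C p.K.C p.R.C G.C H.C m.fC n.fC ∧
  GraphStep p.L.T p.K.T p.R.T G.T H.T m.fT n.fT ∧
  RelStep p.L.σV p.K.σV p.R.σV G.σV H.σV H.C.verts H.S.verts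
    m.fC.onV m.fS.onV n.fC.onV n.fS.onV ∧
  RelStep p.L.σE p.K.σE p.R.σE G.σE H.σE H.C.edgeNames H.S.edgeNames
    m.fC.onE m.fS.onE n.fC.onE n.fS.onE ∧
  RelStep p.L.τV p.K.τV p.R.τV G.τV H.τV H.C.verts H.T.verts
    m.fC.onV m.fT.onV n.fC.onV n.fT.onV ∧
  RelStep p.L.τE p.K.τE p.R.τE G.τE H.τE H.C.edgeNames H.T.edgeNames
    m.fC.onE m.fT.onE n.fC.onE n.fT.onE

/-- A triple graph grammar: a set of (plain, monotonic) triple rules and a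
start triple graph. -/
structure TGG (V E : Type) where
  rules : Set (Rule V E)
  start : Triple V E

/-- The language of a TGG: all triple graphs reachable from the start graph by
transformation steps via rules of the grammar. -/
def TGG.lang (GG : TGG V E) : Set (Triple V E) :=
  {H | Relation.ReflTransGen
        (fun G G' => ∃ p ∈ GG.rules, ∃ m n : TMap V E, IsStep p G G' m n) GG.start H}

/-- The nodes marked by an application of the forward rule of `p` at match `m`:
the images of the source marking elements `R_S \ L_S`. -/
def markedV (p : Rule V E) (m : TMap V E) : Set V :=
  m.fS.onV '' (p.R.S.verts \ p.L.S.verts)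

/-- The edges marked by an application of the forward rule of `p` at match `m`. -/
def markedE (p : Rule V E) (m : TMap V E) : Set (E × V × V) :=
  m.fS.onEdge '' (p.R.S.edges \ p.L.S.edges)

/-- The images of the required elements (nodes of `L_S`). -/
def requiredV (p : Rule V E) (m : TMap V E) : Set V := m.fS.onV '' p.L.S.verts

/-- The images of the required elements (edges of `L_S`). -/
def requiredE (p : Rule V E) (m : TMap V E) : Set (E × V × V) := m.fS.onEdge '' p.L.S.edges

/-- A transformation sequence `G_0 ⇒ … ⇒ G_t` via the forward rules of the
rules `ps i` at matches `ms i` with comatches `ns i`. -/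
def FwdSequence (t : ℕ) (Gs : ℕ → Triple V E) (ps : ℕ → Rule V E)
    (ms ns : ℕ → TMap V E) : Prop :=
  ∀ i, i < t → IsStep (ps i).fwd (Gs i) (Gs (i + 1)) (ms i) (ns i)

/-- No two rule applications of the sequence mark the same element. -/
def CreationPreserving (t : ℕ) (ps : ℕ → Rule V E) (ms : ℕ → TMap V E) : Prop :=
  ∀ i j, i < t → j < t → i ≠ j →
    markedV (ps i) (ms i) ∩ markedV (ps j) (ms j) = ∅ ∧
    markedE (ps i) (ms i) ∩ markedE (ps j) (ms j) = ∅

/-- All required elements of each rule application have been marked by a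
previous rule application of the sequence. -/
def ContextPreserving (t : ℕ) (ps : ℕ → Rule V E) (ms : ℕ → TMap V E) : Prop :=
  ∀ i, i < t →
    (∀ v ∈ requiredV (ps i) (ms i), ∃ k, k < i ∧ v ∈ markedV (ps k) (ms k)) ∧
    (∀ e ∈ requiredE (ps i) (ms i), ∃ k, k < i ∧ e ∈ markedE (ps k) (ms k))

def ConsistentlyMarking (t : ℕ) (ps : ℕ → Rule V E) (ms : ℕ → TMap V E) : Prop :=
  CreationPreserving t ps ms ∧ ContextPreserving t ps ms

/-- Every element of the common source graph `GS` is marked by some rule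
application of the sequence. -/
def EntirelyMarking (t : ℕ) (ps : ℕ → Rule V E) (ms : ℕ → TMap V E) (GS : Graph V E) : Prop :=
  (∀ v ∈ GS.verts, ∃ i, i < t ∧ v ∈ markedV (ps i) (ms i)) ∧
  (∀ e ∈ GS.edges, ∃ i, i < t ∧ e ∈ markedE (ps i) (ms i))

/-- A common kernel for the pair of monotonic rules `(r1, r2)`. -/
def IsCommonKernel (r1 r2 : Rule V E) (Lcap Rcap : Triple V E) : Prop :=
  Lcap.Sub r1.L ∧ Lcap.Sub r2.L ∧ Rcap.Sub r1.R ∧ Rcap.Sub r2.R ∧ Lcap.Sub Rcap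

/-- `rsc` is the short-cut rule of `(r1, r2)` (with `r1` applied inversely)
w.r.t. the common kernel `(Lcap, Rcap)`:
`L_sc = R_1 ∪_{L_1} L∪`, `K_sc = L∪ ∪_{L∩} R∩`, `R_sc = R_2 ∪_{L_2} L∪`,
where `L∪ = L_1 ∪_{L∩} L_2`, and the unions are taken along the respective
common subgraphs (whence the `MeetIn` assumptions). -/
def IsShortcutRule (r1 r2 : Rule V E) (Lcap Rcap : Triple V E) (rsc : Rule V E) : Prop :=
  IsCommonKernel r1 r2 Lcap Rcap ∧
  Triple.MeetIn r1.L r2.L Lcap ∧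
  Triple.MeetIn r1.R (r1.L.union r2.L) r1.L ∧
  Triple.MeetIn r2.R (r1.L.union r2.L) r2.L ∧
  Triple.MeetIn (r1.L.union r2.L) Rcap Lcap ∧
  rsc.L = r1.R.union (r1.L.union r2.L) ∧
  rsc.K = (r1.L.union r2.L).union Rcap ∧
  rsc.R = r2.R.union (r1.L.union r2.L)

/-- A set of negative application conditions for a rule with left-hand side
`L`: a finite set of (partial) triple graphs, each containing `L`. -/
def IsNACSet (L : Triple V E) (N : Set (Triple V E)) : Prop :=
  N.Finite ∧ ∀ X ∈ N, L.Sub X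

/-- An (injective) match `m : L → G` satisfies the NAC set `N` if for no
`X ∈ N` there is an injective morphism `X → G` restricting to `m` on `L`. -/
def SatisfiesNACs (L : Triple V E) (N : Set (Triple V E)) (G : Triple V E)
    (m : TMap V E) : Prop :=
  ∀ X ∈ N, ¬ ∃ x : TMap V E, x.IsHom X G ∧ x.InjOn X ∧ x.EqOn m L

/-- One graph component of sequential independence:
`n1(R1) ∩ m2(L2) ⊆ n1(K1) ∩ m2(K2)`. -/
def GIndep (R1 K1 L2 K2 : Graph V E) (n1 m2 : GMap V E) : Prop :=
  ((n1.onV '' R1.verts) ∩ (m2.onV '' L2.verts) ⊆ (n1.onV '' K1.verts) ∩ (m2.onV '' K2.verts)) ∧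
  ((n1.onEdge '' R1.edges) ∩ (m2.onEdge '' L2.edges) ⊆
    (n1.onEdge '' K1.edges) ∩ (m2.onEdge '' K2.edges))

/-- Sequential independence of two consecutive transformation steps via plain
rules `r1` and `r2`, where `n1` is the comatch of the first and `m2` the match
of the second step. -/
def SeqIndep (r1 r2 : Rule V E) (n1 m2 : TMap V E) : Prop :=
  GIndep r1.R.S r1.K.S r2.L.S r2.K.S n1.fS m2.fS ∧
  GIndep r1.R.C r1.K.C r2.L.C r2.K.C n1.fC m2.fC ∧
  GIndep r1.R.T r1.K.T r2.L.T r2.K.T n1.fT m2.fT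

theorem edgeNames_mono' {V E : Type} {A B : Graph V E} (h : A.edges ⊆ B.edges) :
    A.edgeNames ⊆ B.edgeNames := fun _ ⟨u, w, he⟩ => ⟨u, w, h he⟩

theorem corr_cod' {V E : Type} {C S : Graph V E} {rV : Set (V × V)} {rE : Set (E × E)}
    (h : Triple.CorrWF C S rV rE) : ∀ q ∈ rE, q.2 ∈ S.edgeNames := by
  intro q hq
  obtain ⟨_, _, _, h4, h5⟩ := h
  obtain ⟨u, w, he⟩ := h5 q hq
  obtain ⟨u', w', he', _⟩ := h4 q hq u w he
  exact ⟨u', w', he'⟩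

theorem corr_mono' {V E : Type} {C S S' : Graph V E} {rV : Set (V × V)} {rE : Set (E × E)}
    (h : Triple.CorrWF C S rV rE) (hs : S.Sub S') : Triple.CorrWF C S' rV rE := by
  obtain ⟨h1, h2, h3, h4, h5⟩ := h
  refine ⟨fun q hq => ⟨(h1 q hq).1, hs.1 (h1 q hq).2⟩, h2, h3, fun q hq u w he => ?_, h5⟩
  obtain ⟨u', w', a, b, c⟩ := h4 q hq u w he
  exact ⟨u', w', hs.2 a, b, c⟩

theorem restrict_eq' {α : Type} {Lr Rr : Set (α × α)} {D : Set α} (hsub : Lr ⊆ Rr)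
    (hdom : ∀ q ∈ Lr, q.1 ∈ D) (htot : ∀ c ∈ D, ∃ s, (c, s) ∈ Lr)
    (hfun : ∀ p ∈ Rr, ∀ q ∈ Rr, p.1 = q.1 → p = q) :
    {q ∈ Rr | q.1 ∈ D} = Lr := by
  ext q
  constructor
  · rintro ⟨hq, hD⟩
    obtain ⟨s, hs⟩ := htot _ hD
    rw [hfun q hq _ (hsub hs) rfl]
    exact hs
  · exact fun hq => ⟨hsub hq, hdom q hq⟩

theorem relStep_mono' {α : Type} {Lr Rr Gr Hr : Set (α × α)} {D C : Set α}
    {mc ms nc ns : α → α} :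
    RelStep Lr Lr Rr Gr Hr D C mc ms nc ns ↔
      Hr = {q ∈ Gr | q.1 ∈ D ∧ q.2 ∈ C} ∪
        ((fun q : α × α => (nc q.1, ns q.2)) '' (Rr \ Lr)) := by
  simp [RelStep]

theorem relStep_id' {α : Type} {Gr : Set (α × α)} {D C : Set α}
    {mc ms nc ns : α → α} (h : ∀ q ∈ Gr, q.1 ∈ D ∧ q.2 ∈ C) :
    RelStep ∅ ∅ ∅ Gr Gr D C mc ms nc ns := by
  rw [relStep_mono']
  ext q
  simp only [Set.sdiff_self, Set.image_empty, Set.union_empty, Set.mem_ofPred_eq]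
  exact ⟨fun hq => ⟨hq, h q hq⟩, fun hq => hq.1⟩

theorem graphStep_id' {V E : Type} (K G : Graph V E) {m n : GMap V E}
    (hv : ∀ v ∈ K.verts, n.onV v = m.onV v) (he : ∀ e ∈ K.edgeNames, n.onE e = m.onE e) :
    GraphStep K K K G G m n := by
  refine ⟨hv, he, ?_, ?_, ?_, ?_⟩ <;> simp

theorem graphStep_congr' {V E : Type} {L R G H : Graph V E} {m n n' : GMap V E}
    (hR : R.WF) (hLR : L.Sub R)
    (hv : ∀ v ∈ R.verts, n'.onV v = n.onV v) (he : ∀ e ∈ R.edgeNames, n'.onE e = n.onE e)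
    (h : GraphStep L L R G H m n) : GraphStep L L R G H m n' := by
  obtain ⟨h1, h2, h3, h4, h5, h6⟩ := h
  refine ⟨fun v h => (hv v (hLR.1 h)).trans (h1 v h),
    fun e h => (he e (edgeNames_mono' hLR.2 h)).trans (h2 e h),
    fun v h => by rw [hv v h.1]; exact h3 v h,
    fun e h => by rw [he e h.1]; exact h4 e h, ?_, ?_⟩
  · rw [h5, Set.image_congr (fun v (h : v ∈ R.verts \ L.verts) => hv v h.1)]
  · rw [h6, Set.image_congr (f := n'.onEdge) (g := n.onEdge)]
    intro x hx
    have := hR.1 x hx.1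
    simp only [GMap.onEdge]
    rw [hv _ this.1, hv _ this.2, he x.1 ⟨_, _, hx.1⟩]

theorem graphStep_sub' {V E : Type} {L R G H : Graph V E} {m n : GMap V E}
    (h : GraphStep L L R G H m n) : G.Sub H := by
  obtain ⟨_, _, _, _, h5, h6⟩ := h
  constructor
  · rw [h5]; simp
  · rw [h6]; simp

/-- For a plain monotonic triple rule `p` and triple graphs
`G` and `H`, there is a transformation step `G ⇒_{p,m} H` at the injective
match `m = (m_S, m_C, m_T)` if and only if there are transformation steps
`G ⇒_{p^S} G' ⇒_{p^F} H`, where `G' = (H_S ← G_C → G_T)` (the correspondence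
morphism of `G` composed with the inclusion `G_S ⊆ H_S`), the source rule is
applied at the match `(m_S, ∅, ∅)` (realized by `m` itself, whose
correspondence and target components act on the empty graphs), and the forward
rule at the match `(n_S, m_C, m_T)` with `n_S` the source component of the
comatch of the first step. -/
theorem rule_step_iff_source_then_forward
    {V E : Type} (p : Rule V E) (hmono : p.Monotonic) (hWF : p.WF) (htot : p.TotalRule)
    (G H : Triple V E) (hGtot : G.Total) (hHtot : H.Total) (m : TMap V E) :
    (∃ n : TMap V E, IsStep p G H m n) ↔
      (∃ n nF : TMap V E,
        IsStep p.srcRule G (⟨H.S, G.C, G.T, G.σV, G.σE, G.τV, G.τE⟩ : Triple V E) m n ∧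
        IsStep p.fwd (⟨H.S, G.C, G.T, G.σV, G.σE, G.τV, G.τE⟩ : Triple V E) H
          ⟨n.fS, m.fC, m.fT⟩ nF) := by
  obtain ⟨L, K, R⟩ := p
  obtain rfl : K = L := hmono
  obtain ⟨hL, -, hR, -, hLR⟩ := hWF
  obtain ⟨hLt, -, -⟩ := htot
  simp only at hL hR hLR hLt
  have hcL := hL.2.2.2.1
  have hcR := hR.2.2.2.1
  have e1 : {q ∈ R.σV | q.1 ∈ K.C.verts} = K.σV :=
    restrict_eq' hLR.2.2.2.1 (fun q hq => (hcL.1 q hq).1) hLt.1 hcR.2.1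
  have e2 : {q ∈ R.σE | q.1 ∈ K.C.edgeNames} = K.σE :=
    restrict_eq' hLR.2.2.2.2.1 hcL.2.2.2.2 hLt.2.1 hcR.2.2.1
  have hf : (Rule.mk K K R).fwd =
      ⟨⟨R.S, K.C, K.T, K.σV, K.σE, K.τV, K.τE⟩, ⟨R.S, K.C, K.T, K.σV, K.σE, K.τV, K.τE⟩, R⟩ := by
    simp only [Rule.fwd, Rule.fwdL, e1, e2]
  rw [hf]
  constructor
  · rintro ⟨n, hG, hH, hm, hmi, hn, hni, sS, sC, sT, r1, r2, r3, r4⟩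
    simp only at hm hmi hn hni sS sC sT r1 r2 r3 r4
    have hsub := graphStep_sub' sS
    have hG' : (⟨H.S, G.C, G.T, G.σV, G.σE, G.τV, G.τE⟩ : Triple V E).WF :=
      ⟨hH.1, hG.2.1, hG.2.2.1, corr_mono' hG.2.2.2.1 hsub, hG.2.2.2.2⟩
    refine ⟨n, n, ⟨hG, hG', ?_, ?_, ?_, ?_, sS, ?_, ?_, ?_, ?_, ?_, ?_⟩,
      ⟨hG', hH, ?_, ?_, hn, hni, ?_, sC, sT, ?_, ?_, ?_, ?_⟩⟩
    · refine ⟨hm.1, ?_, ?_, ?_, ?_, ?_, ?_⟩ <;>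
        simp [Rule.srcRule, Triple.srcOnly, GMap.IsHom, Graph.emptyG]
    · refine ⟨hmi.1, ?_, ?_⟩ <;>
        simp [Rule.srcRule, Triple.srcOnly, GMap.InjOn, Graph.emptyG, Graph.edgeNames]
    · refine ⟨hn.1, ?_, ?_, ?_, ?_, ?_, ?_⟩ <;>
        simp [Rule.srcRule, Triple.srcOnly, GMap.IsHom, Graph.emptyG]
    · refine ⟨hni.1, ?_, ?_⟩ <;>
        simp [Rule.srcRule, Triple.srcOnly, GMap.InjOn, Graph.emptyG, Graph.edgeNames]
    · apply graphStep_id' (Graph.emptyG V E) <;> simp [Graph.emptyG, Graph.edgeNames]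
    · apply graphStep_id' (Graph.emptyG V E) <;> simp [Graph.emptyG, Graph.edgeNames]
    · exact relStep_id' hG'.2.2.2.1.1
    · exact relStep_id' fun q hq => ⟨hG'.2.2.2.1.2.2.2.2 q hq, corr_cod' hG'.2.2.2.1 q hq⟩
    · exact relStep_id' hG'.2.2.2.2.1
    · exact relStep_id' fun q hq => ⟨hG'.2.2.2.2.2.2.2.2 q hq, corr_cod' hG'.2.2.2.2 q hq⟩
    · obtain ⟨a1, a2, a3, a4, a5, a6, a7⟩ := hm
      refine ⟨hn.1, a2, a3, ?_, ?_, a6, a7⟩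
      · intro q hq
        have := a4 q hq
        rw [← sS.1 q.2 (hcL.1 q hq).2] at this
        exact this
      · intro q hq
        have := a5 q hq
        rw [← sS.2.1 q.2 (corr_cod' hcL q hq)] at this
        exact this
    · exact ⟨hni.1, hmi.2.1, hmi.2.2⟩
    · exact graphStep_id' _ _ (fun _ _ => rfl) (fun _ _ => rfl)
    · exact relStep_mono'.2 (relStep_mono'.1 r1)
    · exact relStep_mono'.2 (relStep_mono'.1 r2)
    · exact relStep_mono'.2 (relStep_mono'.1 r3)
    · exact relStep_mono'.2 (relStep_mono'.1 r4)
  · rintro ⟨n, nF, ⟨hG, hG', hm, hmi, hn, hni, sS, -, -, -, -, -, -⟩,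
      ⟨-, hH, hmF, hmFi, hnF, hnFi, tS, tC, tT, r1, r2, r3, r4⟩⟩
    simp only at hmF hmFi hnF hnFi tS tC tT r1 r2 r3 r4
    refine ⟨nF, hG, hH, ?_, ?_, hnF, hnFi, ?_, tC, tT, ?_, ?_, ?_, ?_⟩
    · obtain ⟨a1, a2, a3, a4, a5, a6, a7⟩ := hmF
      refine ⟨hm.1, a2, a3, ?_, ?_, a6, a7⟩
      · intro q hq
        have := a4 q hq
        have h2 : n.fS.onV q.2 = m.fS.onV q.2 := sS.1 q.2 (hcL.1 q hq).2
        simp only [h2] at this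
        exact this
      · intro q hq
        have := a5 q hq
        have h2 : n.fS.onE q.2 = m.fS.onE q.2 := sS.2.1 q.2 (corr_cod' hcL q hq)
        simp only [h2] at this
        exact this
    · exact ⟨hmi.1, hmFi.2.1, hmFi.2.2⟩
    · exact graphStep_congr' hR.1 hLR.1 tS.1 tS.2.1 sS
    · exact relStep_mono'.2 (relStep_mono'.1 r1)
    · exact relStep_mono'.2 (relStep_mono'.1 r2)
    · exact relStep_mono'.2 (relStep_mono'.1 r3)
    · exact relStep_mono'.2 (relStep_mono'.1 r4)

end TGGPaper
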